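/- arXiv:math/0306057 — 8 statements merged into one kernel-verified Lean document; each statement's English description precedes it below -/
import Mathlib

section
/- Let n ≥ 1, let c(i,j) be integers for 1 ≤ i < j ≤ n with c(i,i) := 1, let b(i,j) be the associated Bott numbers, and let w = w_1…w_k ∈ {0,1}^k with k ≤ n. Then for any 1 ≤ i < j ≤ k, ∑_{l ∈ 𝕀_i^j ∪ {i}} b({l} ∪ 𝕆_l^j ∪ {j}) · b(i,l) + b(i,j) = 0, where b(i,i) = -1 and b({l} ∪ 𝕆_l^j ∪ {j}) denotes the Bott number of the subset {l} ∪ 𝕆_l^j ∪ {j} of {1,…,n}. -/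
/-- The upper-triangular matrix `C(I)` with `(r,s)` entry `c i_r i_s` for `r ≤ s`
(and `0` below the diagonal), where `i_1 < … < i_m` lists the elements of `I`. -/
noncomputable def CofSet (c : ℕ → ℕ → ℤ) (I : Finset ℕ) : Matrix (Fin I.card) (Fin I.card) ℤ :=
  Matrix.of fun r s =>
    if (r : ℕ) ≤ (s : ℕ) then c (I.orderIsoOfFin rfl r).1 (I.orderIsoOfFin rfl s).1 else 0

/-- The Bott number `b(I)` of a subset `I`: the top-right entry of `B(I) = -C(I)⁻¹`. -/
noncomputable def bottOfSet (c : ℕ → ℕ → ℤ) (I : Finset ℕ) : ℤ :=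
  if h : 0 < I.card then (-(CofSet c I)⁻¹) ⟨0, h⟩ ⟨I.card - 1, by omega⟩ else 0

theorem bott_key (c : ℕ → ℕ → ℤ) (I : Finset ℕ) (g : ℕ → ℤ) (l j : ℕ)
    (hl : l ∈ I) (hlmin : ∀ x ∈ I, l ≤ x) (hj : j ∈ I) (hjmax : ∀ x ∈ I, x ≤ j)
    (hd : ∀ x ∈ I, c x x = 1)
    (hg : ∀ x ∈ I, ∑ p ∈ I, (if x ≤ p then c x p * g p else 0) = if x = j then -1 else 0) :
    bottOfSet c I = g l := by
  have hpos : 0 < I.card := Finset.card_pos.mpr ⟨l, hl⟩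
  set e := I.orderIsoOfFin rfl with he
  have hdet : (CofSet c I).det = 1 := by
    rw [Matrix.det_of_isUpperTriangular]
    · apply Finset.prod_eq_one
      intro r _
      simp only [CofSet, Matrix.of_apply, le_refl, if_true]
      exact hd _ (I.orderIsoOfFin rfl r).2
    · intro r s hrs
      have : ¬ (r : ℕ) ≤ (s : ℕ) := by
        have : s < r := hrs
        exact not_le.mpr this
      simp only [CofSet, Matrix.of_apply, if_neg this]
  have he0 : (e ⟨0, hpos⟩ : ℕ) = l := by
    apply le_antisymm
    · have : e ⟨0, hpos⟩ ≤ e (e.symm ⟨l, hl⟩) := e.monotone (Fin.mk_le_of_le_val (Nat.zero_le _))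
      rw [e.apply_symm_apply] at this
      exact this
    · exact hlmin _ (e ⟨0, hpos⟩).2
  have hlast : (e ⟨I.card - 1, by omega⟩ : ℕ) = j := by
    apply le_antisymm
    · exact hjmax _ (e _).2
    · have : e (e.symm ⟨j, hj⟩) ≤ e ⟨I.card - 1, by omega⟩ := by
        apply e.monotone
        have := (e.symm ⟨j, hj⟩).2
        exact Fin.le_def.mpr (by simp only; omega)
      rw [e.apply_symm_apply] at this
      exact this
  let last : Fin I.card := ⟨I.card - 1, by omega⟩
  have hmul : (CofSet c I).mulVec (fun s => g (e s)) = fun r => if r = last then -1 else 0 := by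
    funext r
    have h := hg (e r) (e r).2
    rw [← Finset.sum_coe_sort I, ← Equiv.sum_comp e.toEquiv] at h
    have h2 : ((e r : ℕ) = j) ↔ r = last := by
      rw [← hlast]
      constructor
      · intro hh
        exact e.injective (Subtype.ext hh)
      · intro hh
        rw [hh]
    simp only [h2] at h
    rw [← h]
    simp only [Matrix.mulVec, dotProduct]
    apply Finset.sum_congr rfl
    intro s _
    have h3 : ((e r : ℕ) ≤ (e s : ℕ)) ↔ (r : ℕ) ≤ (s : ℕ) := by
      rw [← Fin.le_def, ← e.le_iff_le]
      rfl
    simp only [CofSet, Matrix.of_apply, ite_mul, zero_mul]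
    change _ = if (e r : ℕ) ≤ (e s : ℕ) then c (e r) (e s) * g (e s) else 0
    simp only [h3]
    rfl
  have hu : IsUnit (CofSet c I).det := by rw [hdet]; exact isUnit_one
  have hinv : (fun s => g (e s)) = (CofSet c I)⁻¹.mulVec (fun r => if r = last then -1 else 0) := by
    rw [← hmul, Matrix.mulVec_mulVec, Matrix.nonsing_inv_mul _ hu, Matrix.one_mulVec]
  have := congrFun hinv ⟨0, hpos⟩
  simp only [he0] at this
  rw [this, bottOfSet, dif_pos hpos]
  simp [Matrix.mulVec, dotProduct, last]

/-- Auxiliary solution vector. -/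
def bottG (c : ℕ → ℕ → ℤ) (w : ℕ → Bool) (j : ℕ) (m : ℕ) : ℤ :=
  if j ≤ m then -1 else
    -∑ p ∈ (Finset.Ioc m j).attach,
      if w p.1 = false ∨ p.1 = j then c m p.1 * bottG c w j p.1 else 0
termination_by j - m
decreasing_by
  have := Finset.mem_Ioc.mp p.2
  omega

theorem bottG_self (c : ℕ → ℕ → ℤ) (w : ℕ → Bool) (j : ℕ) : bottG c w j j = -1 := by
  rw [bottG]; simp

theorem bottG_lt (c : ℕ → ℕ → ℤ) (w : ℕ → Bool) (j m : ℕ) (h : m < j) :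
    bottG c w j m = c m j - ∑ p ∈ Finset.Ioo m j,
      if w p = false then c m p * bottG c w j p else 0 := by
  rw [bottG, if_neg (not_le.mpr h), Finset.sum_attach (Finset.Ioc m j)
    (fun p => if w p = false ∨ p = j then c m p * bottG c w j p else 0),
    ← Finset.Ioo_insert_right h, Finset.sum_insert (by simp)]
  rw [if_pos (Or.inr rfl), bottG_self]
  have : ∀ p ∈ Finset.Ioo m j, (if w p = false ∨ p = j then c m p * bottG c w j p else 0)
      = if w p = false then c m p * bottG c w j p else 0 := by
    intro p hp
    have : p ≠ j := (Finset.mem_Ioo.mp hp).2.ne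
    simp [this]
  rw [Finset.sum_congr rfl this]
  ring

theorem bottOfSet_eq_bottG (c : ℕ → ℕ → ℤ) (w : ℕ → Bool) (l j : ℕ) (hlj : l < j)
    (hd : ∀ x, l ≤ x → x ≤ j → c x x = 1) :
    bottOfSet c (insert l (((Finset.Ioo l j).filter fun m => w m = false) ∪ {j}))
      = bottG c w j l := by
  have hmem : ∀ x, x ∈ (insert l (((Finset.Ioo l j).filter fun m => w m = false) ∪ {j})) ↔
      x = l ∨ (((l < x ∧ x < j) ∧ w x = false) ∨ x = j) := by
    intro x; simp only [Finset.mem_insert, Finset.mem_union, Finset.mem_filter, Finset.mem_Ioo,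
      Finset.mem_singleton]
  apply bott_key c _ _ l j
  · rw [hmem]; exact Or.inl rfl
  · intro x hx; rw [hmem] at hx; omega
  · rw [hmem]; exact Or.inr (Or.inr rfl)
  · intro x hx; rw [hmem] at hx; omega
  · intro x hx; rw [hmem] at hx; exact hd x (by omega) (by omega)
  · intro x hx
    rw [hmem] at hx
    rw [← Finset.sum_filter]
    by_cases hxj : x = j
    · subst hxj
      rw [if_pos rfl]
      have : (insert l (((Finset.Ioo l x).filter fun m => w m = false) ∪ {x})).filter (x ≤ ·)
          = {x} := by
        ext p
        rw [Finset.mem_filter, hmem, Finset.mem_singleton]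
        constructor
        · rintro ⟨h, h'⟩; omega
        · rintro rfl; exact ⟨Or.inr (Or.inr rfl), le_rfl⟩
      rw [this, Finset.sum_singleton, bottG_self, hd x (by omega) le_rfl]
      rfl
    · rw [if_neg hxj]
      have hxlt : x < j := by omega
      have : (insert l (((Finset.Ioo l j).filter fun m => w m = false) ∪ {j})).filter (x ≤ ·)
          = insert x (insert j ((Finset.Ioo x j).filter fun m => w m = false)) := by
        ext p
        rw [Finset.mem_filter, hmem]
        simp only [Finset.mem_insert, Finset.mem_filter, Finset.mem_Ioo]
        grind
      rw [this, Finset.sum_insert (by simp; omega), Finset.sum_insert (by simp),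
        Finset.sum_filter, bottG_self, bottG_lt c w j x hxlt, hd x (by omega) (by omega)]
      ring

theorem bott_main (n : ℕ) (c b : ℕ → ℕ → ℤ)
    (hbdiag : ∀ i, 1 ≤ i → i ≤ n → b i i = -1)
    (hbrec : ∀ i j, 1 ≤ i → i < j → j ≤ n →
      b i j = -∑ m ∈ Finset.Ioc i j, c i m * b m j)
    (w : ℕ → Bool) (j : ℕ) (hj : j ≤ n) (d : ℕ) : ∀ i, 1 ≤ i → i < j → j - i ≤ d →
    b i j = bottG c w j i - ∑ l ∈ Finset.Ioo i j,
      if w l = true then bottG c w j l * b i l else 0 := by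
  induction d with
  | zero => intro i _ _ _; omega
  | succ d ih =>
    intro i h1 hij hd
    have hrec' : ∀ l, i < l → l ≤ n →
        b i l = c i l - ∑ m ∈ Finset.Ioo i l, c i m * b m l := by
      intro l hil hln
      rw [hbrec i l h1 hil hln, ← Finset.Ioo_insert_right hil, Finset.sum_insert (by simp),
        hbdiag l (by omega) hln]
      ring
    have A : ∑ m ∈ Finset.Ioo i j, c i m * b m j =
        ∑ m ∈ Finset.Ioo i j, c i m * bottG c w j m -
        ∑ m ∈ Finset.Ioo i j, ∑ l ∈ Finset.Ioo m j,
          c i m * (if w l = true then bottG c w j l * b m l else 0) := by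
      rw [← Finset.sum_sub_distrib]
      apply Finset.sum_congr rfl
      intro m hm
      rw [Finset.mem_Ioo] at hm
      rw [ih m (by omega) hm.2 (by omega), mul_sub, Finset.mul_sum]
    have B : ∑ m ∈ Finset.Ioo i j, ∑ l ∈ Finset.Ioo m j,
          c i m * (if w l = true then bottG c w j l * b m l else 0) =
        ∑ l ∈ Finset.Ioo i j, ∑ m ∈ Finset.Ioo i l,
          c i m * (if w l = true then bottG c w j l * b m l else 0) := by
      apply Finset.sum_comm'
      intro x y
      simp only [Finset.mem_Ioo]
      omega
    have C : ∑ l ∈ Finset.Ioo i j, ∑ m ∈ Finset.Ioo i l,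
          c i m * (if w l = true then bottG c w j l * b m l else 0) =
        ∑ l ∈ Finset.Ioo i j, (c i l * bottG c w j l
          - (if w l = false then c i l * bottG c w j l else 0)
          - (if w l = true then bottG c w j l * b i l else 0)) := by
      apply Finset.sum_congr rfl
      intro l hl
      rw [Finset.mem_Ioo] at hl
      cases hw : w l
      · simp
      · have h := hrec' l hl.1 (by omega)
        simp only [if_true, Bool.true_eq_false, if_false]
        have : ∑ m ∈ Finset.Ioo i l, c i m * (bottG c w j l * b m l)
            = bottG c w j l * ∑ m ∈ Finset.Ioo i l, c i m * b m l := by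
          rw [Finset.mul_sum]
          exact Finset.sum_congr rfl fun m _ => by ring
        rw [this, h]
        ring
    rw [Finset.sum_sub_distrib, Finset.sum_sub_distrib] at C
    rw [hrec' j hij hj, A, B, C, bottG_lt c w j i hij]
    ring

/-- for a binary code `w ∈ {0,1}^k` (`k ≤ n`) and `1 ≤ i < j ≤ k`,
`∑_{l ∈ 𝕀_i^j ∪ {i}} b({l} ∪ 𝕆_l^j ∪ {j}) * b(i,l) + b(i,j) = 0`, where
`𝕀_i^j = {l : i < l < j, w l = 1}` and `𝕆_l^j = {m : l < m < j, w m = 0}`. -/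
theorem bott_relation_left (n k : ℕ) (hn : 1 ≤ n) (hk : k ≤ n) (c b : ℕ → ℕ → ℤ)
    (hc : ∀ i, 1 ≤ i → i ≤ n → c i i = 1)
    (hbdiag : ∀ i, 1 ≤ i → i ≤ n → b i i = -1)
    (hbzero : ∀ i j, 1 ≤ j → j < i → i ≤ n → b i j = 0)
    (hbrec : ∀ i j, 1 ≤ i → i < j → j ≤ n →
      b i j = -∑ m ∈ Finset.Ioc i j, c i m * b m j)
    (w : ℕ → Bool) (i j : ℕ) (h1 : 1 ≤ i) (hij : i < j) (hjk : j ≤ k) :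
    ∑ l ∈ insert i ((Finset.Ioo i j).filter fun l => w l = true),
        bottOfSet c (insert l (((Finset.Ioo l j).filter fun m => w m = false) ∪ {j})) * b i l
      + b i j = 0 := by
  have hsum : ∀ l ∈ insert i ((Finset.Ioo i j).filter fun l => w l = true),
      bottOfSet c (insert l (((Finset.Ioo l j).filter fun m => w m = false) ∪ {j})) * b i l
      = bottG c w j l * b i l := by
    intro l hl
    have : i ≤ l ∧ l < j := by
      simp only [Finset.mem_insert, Finset.mem_filter, Finset.mem_Ioo] at hl
      omega
    rw [bottOfSet_eq_bottG c w l j this.2 fun x hx hx' => hc x (by omega) (by omega)]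
  rw [Finset.sum_congr rfl hsum, Finset.sum_insert (by simp), Finset.sum_filter,
    bott_main n c b hbdiag hbrec w j (by omega) (j - i) i h1 hij le_rfl,
    hbdiag i h1 (by omega)]
  ring
end

section
/- Let n ≥ 1, let c(i,j) be integers for 1 ≤ i < j ≤ n with c(i,i) := 1, let b(i,j) be the associated Bott numbers, and let w = w_1…w_k ∈ {0,1}^k with k ≤ n. Then for any 1 ≤ i < j ≤ k, ∑_{l ∈ 𝕀_i^j ∪ {j}} b({i} ∪ 𝕆_i^l ∪ {l}) · b(l,j) + b(i,j) = 0, where b(j,j) = -1 and b({i} ∪ 𝕆_i^l ∪ {l}) denotes the Bott number of the subset {i} ∪ 𝕆_i^l ∪ {l} of {1,…,n}. -/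
theorem bott_key_s4 (c : ℕ → ℕ → ℤ) (I : Finset ℕ) (β : ℕ → ℤ) (i l : ℕ)
    (hi : i ∈ I) (hl : l ∈ I) (hmin : ∀ m ∈ I, i ≤ m) (hmax : ∀ m ∈ I, m ≤ l)
    (hc : ∀ m ∈ I, c m m = 1) (hβi : β i = -1)
    (hβ : ∀ s ∈ I, s ≠ i → ∑ m ∈ I.filter (fun m => m ≤ s), β m * c m s = 0) :
    bottOfSet c I = β l := by
  have hpos : 0 < I.card := Finset.card_pos.mpr ⟨i, hi⟩
  set e := I.orderIsoOfFin rfl with he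
  have hdet : (CofSet c I).det = 1 := by
    rw [Matrix.det_of_upperTriangular]
    · apply Finset.prod_eq_one
      intro r _
      simp only [CofSet, Matrix.of_apply, le_refl, if_true]
      exact hc _ (e r).2
    · intro r s hrs
      have : (s : ℕ) < r := hrs
      simp only [CofSet, Matrix.of_apply]
      rw [if_neg (by omega)]
  have hunit : IsUnit (CofSet c I).det := by rw [hdet]; exact isUnit_one
  have h0 : ((e ⟨0, hpos⟩ : I) : ℕ) = i := by
    apply le_antisymm _ (hmin _ (e _).2)
    have : e ⟨0, hpos⟩ ≤ ⟨i, hi⟩ := by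
      rw [← e.apply_symm_apply ⟨i, hi⟩, e.le_iff_le]
      exact Nat.zero_le _
    exact this
  have hL : ((e ⟨I.card - 1, by omega⟩ : I) : ℕ) = l := by
    apply le_antisymm (hmax _ (e _).2)
    have : (⟨l, hl⟩ : I) ≤ e ⟨I.card - 1, by omega⟩ := by
      rw [← e.apply_symm_apply ⟨l, hl⟩, e.le_iff_le]
      have := (e.symm ⟨l, hl⟩).2
      exact Fin.mk_le_mk.mpr (Nat.le_sub_one_of_lt this)
    exact this
  have hv : Matrix.vecMul (fun r => β (e r).1) (CofSet c I) = -Pi.single ⟨0, hpos⟩ 1 := by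
    funext s
    have h2 : Matrix.vecMul (fun r => β (e r).1) (CofSet c I) s
        = ∑ m ∈ I.filter (fun m => m ≤ (e s).1), β m * c m (e s).1 := by
      rw [Finset.sum_filter, ← Finset.sum_coe_sort I, ← e.toEquiv.sum_comp]
      simp only [Matrix.vecMul, dotProduct]
      apply Finset.sum_congr rfl
      intro r _
      have h3 : ((e r).1 ≤ (e s).1) ↔ (r : ℕ) ≤ s := e.le_iff_le
      simp only [CofSet, Matrix.of_apply, ← he]
      change β (e r).1 * _ = if (e r).1 ≤ (e s).1 then β (e r).1 * c (e r).1 (e s).1 else 0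
      by_cases h : (r : ℕ) ≤ s
      · rw [if_pos h, if_pos (h3.2 h)]
      · rw [if_neg h, if_neg (fun h' => h (h3.1 h')), mul_zero]
    rw [h2]
    by_cases hs : s = ⟨0, hpos⟩
    · subst hs
      rw [h0]
      have : I.filter (fun m => m ≤ i) = {i} := by
        ext m
        simp only [Finset.mem_filter, Finset.mem_singleton]
        constructor
        · rintro ⟨a, b⟩
          exact le_antisymm b (hmin _ a)
        · rintro rfl
          exact ⟨hi, le_rfl⟩
      rw [this]
      simp [hβi, hc i hi]
    · rw [hβ _ (e s).2]
      · simp [hs]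
      · intro h
        apply hs
        apply e.injective
        apply Subtype.ext
        rw [h, h0]
  have hfin : (fun r => β (e r).1) = Matrix.vecMul (-Pi.single ⟨0, hpos⟩ 1) (CofSet c I)⁻¹ := by
    rw [← hv, Matrix.vecMul_vecMul, Matrix.mul_nonsing_inv _ hunit, Matrix.vecMul_one]
  have := congrFun hfin ⟨I.card - 1, by omega⟩
  simp only [hL] at this
  rw [bottOfSet, dif_pos hpos, this, Matrix.neg_vecMul, Matrix.single_one_vecMul]
  rfl

noncomputable def bottBeta (c : ℕ → ℕ → ℤ) (w : ℕ → Bool) (i : ℕ) (s : ℕ) : ℤ :=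
  if s = i then -1 else
    -∑ m : Fin s, if (m : ℕ) = i ∨ (i < (m : ℕ) ∧ w m = false) then
      bottBeta c w i m * c m s else 0
termination_by s
decreasing_by exact m.2

theorem bottBeta_self (c : ℕ → ℕ → ℤ) (w : ℕ → Bool) (i : ℕ) : bottBeta c w i i = -1 := by
  rw [bottBeta, if_pos rfl]

theorem bottBeta_rec (c : ℕ → ℕ → ℤ) (w : ℕ → Bool) (i s : ℕ) (h : i < s) :
    bottBeta c w i s = -∑ m ∈ (Finset.range s).filter
      (fun m => m = i ∨ (i < m ∧ w m = false)), bottBeta c w i m * c m s := by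
  rw [bottBeta, if_neg (by omega), Finset.sum_filter]
  rw [Fin.sum_univ_eq_sum_range (fun m => if m = i ∨ (i < m ∧ w m = false) then
      bottBeta c w i m * c m s else 0) s]

theorem bottBeta_eq (c : ℕ → ℕ → ℤ) (w : ℕ → Bool) (i l : ℕ) (h : i < l)
    (hc : ∀ m, i ≤ m → m ≤ l → c m m = 1) :
    bottOfSet c (insert i (((Finset.Ioo i l).filter fun m => w m = false) ∪ {l}))
      = bottBeta c w i l := by
  apply bott_key_s4 (i := i)
  · simp
  · simp
  · intro m hm
    simp at hm
    omega
  · intro m hm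
    simp at hm
    omega
  · intro m hm
    simp at hm
    apply hc <;> omega
  · exact bottBeta_self c w i
  · intro s hs hne
    have hs' : i < s ∧ s ≤ l := by
      simp at hs
      omega
    have hset : (insert i (((Finset.Ioo i l).filter fun m => w m = false) ∪ {l})).filter
        (fun m => m ≤ s) = insert s ((Finset.range s).filter
          (fun m => m = i ∨ (i < m ∧ w m = false))) := by
      ext m
      simp only [Finset.mem_filter, Finset.mem_insert, Finset.mem_union, Finset.mem_singleton,
        Finset.mem_Ioo, Finset.mem_range] at hs ⊢
      grind
    rw [hset, Finset.sum_insert (by simp), hc s (by omega) hs'.2, bottBeta_rec c w i s hs'.1]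
    ring

/-- for a binary code `w ∈ {0,1}^k` (`k ≤ n`) and `1 ≤ i < j ≤ k`,
`∑_{l ∈ 𝕀_i^j ∪ {j}} b({i} ∪ 𝕆_i^l ∪ {l}) * b(l,j) + b(i,j) = 0`, where
`𝕀_i^j = {l : i < l < j, w l = 1}` and `𝕆_i^l = {m : i < m < l, w m = 0}`. -/
theorem bott_relation_right (n k : ℕ) (hn : 1 ≤ n) (hk : k ≤ n) (c b : ℕ → ℕ → ℤ)
    (hc : ∀ i, 1 ≤ i → i ≤ n → c i i = 1)
    (hbdiag : ∀ i, 1 ≤ i → i ≤ n → b i i = -1)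
    (hbzero : ∀ i j, 1 ≤ j → j < i → i ≤ n → b i j = 0)
    (hbrec : ∀ i j, 1 ≤ i → i < j → j ≤ n →
      b i j = -∑ m ∈ Finset.Ioc i j, c i m * b m j)
    (w : ℕ → Bool) (i j : ℕ) (h1 : 1 ≤ i) (hij : i < j) (hjk : j ≤ k) :
    ∑ l ∈ insert j ((Finset.Ioo i j).filter fun l => w l = true),
        bottOfSet c (insert i (((Finset.Ioo i l).filter fun m => w m = false) ∪ {l})) * b l j
      + b i j = 0 := by
  have hbeta : ∀ l ∈ insert j ((Finset.Ioo i j).filter fun l => w l = true),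
      bottOfSet c (insert i (((Finset.Ioo i l).filter fun m => w m = false) ∪ {l})) * b l j
        = bottBeta c w i l * b l j := by
    intro l hl
    have hl' : i < l ∧ l ≤ j := by
      simp at hl
      omega
    rw [bottBeta_eq c w i l hl'.1 (fun m h2 h3 => hc m (by omega) (by omega))]
  rw [Finset.sum_congr rfl hbeta]
  have hzero : ∀ m ∈ Finset.Ico i j, ∑ l ∈ Finset.Icc m j, c m l * b l j = 0 := by
    intro m hm
    rw [Finset.mem_Ico] at hm
    rw [← Finset.Ioc_insert_left hm.2.le, Finset.sum_insert (by simp),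
      hc m (by omega) (by omega), hbrec m j (by omega) hm.2 (by omega)]
    ring
  have hdbl : ∑ m ∈ (Finset.Ico i j).filter (fun m => m = i ∨ (i < m ∧ w m = false)),
      ∑ l ∈ Finset.Icc m j, bottBeta c w i m * (c m l * b l j) = 0 := by
    apply Finset.sum_eq_zero
    intro m hm
    rw [← Finset.mul_sum, hzero m (Finset.mem_filter.mp hm).1, mul_zero]
  rw [Finset.sum_comm' (t' := Finset.Icc i j) (s' := fun l =>
    ((Finset.Ico i j).filter (fun m => m = i ∨ (i < m ∧ w m = false))).filter
      (fun m => m ≤ l)) (by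
      intro m l
      simp only [Finset.mem_filter, Finset.mem_Ico, Finset.mem_Icc]
      grind)] at hdbl
  have hinner : ∀ l ∈ Finset.Ioc i j,
      ∑ m ∈ ((Finset.Ico i j).filter (fun m => m = i ∨ (i < m ∧ w m = false))).filter
        (fun m => m ≤ l), bottBeta c w i m * (c m l * b l j)
      = if l = j ∨ w l = true then -(bottBeta c w i l * b l j) else 0 := by
    intro l hl
    rw [Finset.mem_Ioc] at hl
    have hrec := bottBeta_rec c w i l hl.1
    simp only [← mul_assoc]
    rw [← Finset.sum_mul]
    split_ifs with h
    · have : ((Finset.Ico i j).filter (fun m => m = i ∨ (i < m ∧ w m = false))).filter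
        (fun m => m ≤ l) = (Finset.range l).filter
          (fun m => m = i ∨ (i < m ∧ w m = false)) := by
        ext m
        simp only [Finset.mem_filter, Finset.mem_Ico, Finset.mem_range]
        grind
      rw [this, hrec]
      ring
    · have : ((Finset.Ico i j).filter (fun m => m = i ∨ (i < m ∧ w m = false))).filter
        (fun m => m ≤ l) = insert l ((Finset.range l).filter
          (fun m => m = i ∨ (i < m ∧ w m = false))) := by
        ext m
        simp only [Finset.mem_filter, Finset.mem_Ico, Finset.mem_range, Finset.mem_insert]
        grind
      rw [this, Finset.sum_insert (by simp), hc l (by omega) (by omega), hrec]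
      ring
  have hi0 : ((Finset.Ico i j).filter (fun m => m = i ∨ (i < m ∧ w m = false))).filter
        (fun m => m ≤ i) = {i} := by
    ext m
    simp only [Finset.mem_filter, Finset.mem_Ico, Finset.mem_singleton]
    grind
  rw [← Finset.Ioc_insert_left hij.le, Finset.sum_insert (by simp), hi0,
    Finset.sum_singleton, Finset.sum_congr rfl hinner, bottBeta_self, hc i h1 (by omega),
    ← Finset.sum_filter, Finset.sum_neg_distrib] at hdbl
  have hset : (Finset.Ioc i j).filter (fun l => l = j ∨ w l = true)
      = insert j ((Finset.Ioo i j).filter fun l => w l = true) := by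
    ext m
    simp only [Finset.mem_filter, Finset.mem_Ioc, Finset.mem_Ioo, Finset.mem_insert]
    grind
  rw [hset] at hdbl
  linarith
end

section
/- Let k ≥ 1, let c(i,j) be integers for 1 ≤ i < j ≤ k with c(i,i) := 1, let b denote the associated Bott numbers, and fix w = w_1…w_k ∈ {0,1}^k. Then the vectors υ_{1,w_1},…,υ_{k,w_k} form the dual basis to a_{1,w_1},…,a_{k,w_k} with respect to the standard inner product on ℝ^k: ⟨υ_{i,w_i}, a_{j,w_j}⟩ = 1 if i = j and 0 if i ≠ j, for all 1 ≤ i, j ≤ k. -/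
/-- The `m`-th coordinate (1-based) of the vector `a_{j, w_j} ∈ ℝ^k`:
`a_{j,0} = e_j` and `a_{j,1} = ∑_{m=j}^{k} b j m • e_m` (recall `b j m = 0` for `m < j`). -/
def aVec (b : ℕ → ℕ → ℤ) (w : ℕ → Bool) (j m : ℕ) : ℝ :=
  if w j then (b j m : ℝ) else if m = j then 1 else 0

/-- The `m`-th coordinate (1-based) of the vector
`υ_{j, w_j} = (-1)^{w_j} (e_j + ∑_{i ∈ 𝕀(j)} b({i} ∪ 𝕆_i^j ∪ {j}) • e_i)`,
where `𝕀(j) = {l : 1 ≤ l < j, w l = 1}` and `𝕆_i^j = {l : i < l < j, w l = 0}`. -/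
noncomputable def upsilonVec (c : ℕ → ℕ → ℤ) (w : ℕ → Bool) (j m : ℕ) : ℝ :=
  (if w j then (-1 : ℝ) else 1) *
    ((if m = j then 1 else 0) +
      if 1 ≤ m ∧ m < j ∧ w m = true then
        (bottOfSet c (insert m (((Finset.Ioo m j).filter fun l => w l = false) ∪ {j})) : ℝ)
      else 0)

noncomputable def betaAux (c : ℕ → ℕ → ℤ) (w : ℕ → Bool) (i : ℕ) (m : ℕ) : ℤ :=
  if h : m < i then
    -∑ l ∈ (Finset.Ioc m i).attach,
      (if (w l.1 = false ∨ l.1 = i) then c m l.1 * betaAux c w i l.1 else 0)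
  else -1
termination_by i - m
decreasing_by
  have := Finset.mem_Ioc.1 l.2
  omega

theorem betaAux_self (c : ℕ → ℕ → ℤ) (w : ℕ → Bool) (i : ℕ) : betaAux c w i i = -1 := by
  rw [betaAux]; simp

theorem betaAux_lt (c : ℕ → ℕ → ℤ) (w : ℕ → Bool) (i m : ℕ) (h : m < i) :
    betaAux c w i m = -∑ l ∈ Finset.Ioc m i,
      (if (w l = false ∨ l = i) then c m l * betaAux c w i l else 0) := by
  rw [betaAux, dif_pos h]
  congr 1
  exact Finset.sum_attach (Finset.Ioc m i)
    (fun l => if (w l = false ∨ l = i) then c m l * betaAux c w i l else 0)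

theorem bott_of_vec (c : ℕ → ℕ → ℤ) (I : Finset ℕ) (v : ℕ → ℤ) (p q : ℕ)
    (hp : p ∈ I) (hq : q ∈ I) (hpm : ∀ l ∈ I, p ≤ l) (hqm : ∀ l ∈ I, l ≤ q)
    (hd : ∀ l ∈ I, c l l = 1)
    (hv : ∀ m ∈ I, ∑ l ∈ I, (if m ≤ l then c m l else 0) * v l = if m = q then -1 else 0) :
    bottOfSet c I = v p := by
  have hcard : 0 < I.card := Finset.card_pos.2 ⟨p, hp⟩
  set e := I.orderIsoOfFin rfl with he
  have hdet : (CofSet c I).det = 1 := by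
    rw [Matrix.det_of_isUpperTriangular]
    · apply Finset.prod_eq_one
      intro r _
      simp only [CofSet, Matrix.of_apply, le_refl, if_true]
      exact hd _ (e r).2
    · intro r s hrs
      have : (s : ℕ) < r := hrs
      simp only [CofSet, Matrix.of_apply]
      rw [if_neg (by omega)]
  have h0 : (e ⟨0, hcard⟩).1 = p := by
    apply le_antisymm
    · have h1 : e ⟨0, hcard⟩ ≤ e (e.symm ⟨p, hp⟩) := e.monotone (Fin.mk_le_of_le_val (Nat.zero_le _))
      rw [e.apply_symm_apply] at h1
      exact h1
    · exact hpm _ (e _).2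
  have hl : ∀ r, (e r).1 = q ↔ r = ⟨I.card - 1, by omega⟩ := by
    have h1 : (e ⟨I.card - 1, by omega⟩).1 = q := by
      apply le_antisymm
      · exact hqm _ (e _).2
      · have h1 : e (e.symm ⟨q, hq⟩) ≤ e ⟨I.card - 1, by omega⟩ :=
          e.monotone (by rw [Fin.le_def]; have := (e.symm ⟨q, hq⟩).2; simp only; omega)
        rw [e.apply_symm_apply] at h1
        exact h1
    intro r
    constructor
    · intro h
      apply e.injective
      apply Subtype.ext
      rw [h, h1]
    · rintro rfl
      exact h1
  have hmul : (CofSet c I).mulVec (fun r => v (e r).1) =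
      -(Pi.single (⟨I.card - 1, by omega⟩ : Fin I.card) (1 : ℤ)) := by
    funext r
    have h1 := hv (e r).1 (e r).2
    rw [← Finset.sum_coe_sort, ← e.toEquiv.sum_comp] at h1
    simp only [Matrix.mulVec, dotProduct, CofSet, Matrix.of_apply]
    have h2 : ∀ s, ((e r).1 ≤ (e s).1) ↔ (r : ℕ) ≤ s := fun s => e.le_iff_le
    simp only [RelIso.coe_fn_toEquiv, h2] at h1
    rw [h1]
    simp only [hl, Pi.neg_apply, Pi.single_apply]
    split_ifs <;> simp
  have hinv := congrArg ((CofSet c I)⁻¹.mulVec) hmul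
  rw [Matrix.mulVec_mulVec, Matrix.nonsing_inv_mul _ (by rw [hdet]; exact isUnit_one),
    Matrix.one_mulVec, Matrix.mulVec_neg, Matrix.mulVec_single_one] at hinv
  have h3 := congrFun hinv ⟨0, hcard⟩
  simp only [h0] at h3
  rw [bottOfSet, dif_pos hcard, h3]
  rfl

theorem bott_eq_beta (k : ℕ) (c : ℕ → ℕ → ℤ) (hc : ∀ i, 1 ≤ i → i ≤ k → c i i = 1)
    (w : ℕ → Bool) (i m : ℕ) (hm : 1 ≤ m) (hmi : m < i) (hik : i ≤ k) :
    bottOfSet c (insert m (((Finset.Ioo m i).filter fun l => w l = false) ∪ {i}))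
      = betaAux c w i m := by
  have hmem : ∀ l, l ∈ (insert m (((Finset.Ioo m i).filter fun l => w l = false) ∪ {i})) ↔
      l = m ∨ (m < l ∧ l < i ∧ w l = false) ∨ l = i := by
    intro l
    simp [and_assoc]
    tauto
  apply bott_of_vec c _ (betaAux c w i) m i
  · simp
  · simp
  · intro l hl
    rw [hmem] at hl
    omega
  · intro l hl
    rw [hmem] at hl
    omega
  · intro l hl
    rw [hmem] at hl
    apply hc <;> omega
  · intro n hn
    have hn' := (hmem n).1 hn
    have hcn : c n n = 1 := by apply hc <;> omega
    rw [← Finset.add_sum_erase _ _ hn]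
    simp only [le_refl, if_true, hcn, one_mul]
    by_cases hni : n = i
    · rw [if_pos hni, Finset.sum_eq_zero, hni, betaAux_self]
      · rfl
      · intro l hl
        rw [Finset.mem_erase, hmem] at hl
        rw [if_neg (by omega), zero_mul]
    · rw [if_neg hni, betaAux_lt c w i n (by omega), neg_add_eq_zero, ← Finset.sum_filter]
      simp only [ite_mul, zero_mul]
      rw [← Finset.sum_filter]
      apply Finset.sum_congr _ (fun _ _ => rfl)
      ext l
      simp only [Finset.mem_filter, Finset.mem_Ioc, Finset.mem_erase, hmem]
      constructor
      · rintro ⟨⟨h1, h2⟩, h3 | h3⟩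
        · by_cases l = i
          · omega
          · refine ⟨⟨by omega, Or.inr (Or.inl ⟨by omega, by omega, h3⟩)⟩, by omega⟩
        · omega
      · rintro ⟨⟨h1, h2 | ⟨h2, h3, h4⟩ | h2⟩, h5⟩
        · omega
        · exact ⟨by omega, Or.inl h4⟩
        · exact ⟨by omega, Or.inr h2⟩

theorem sum_fin_Icc {M : Type*} [AddCommMonoid M] (k : ℕ) (f : ℕ → M) :
    ∑ m : Fin k, f ((m : ℕ) + 1) = ∑ m ∈ Finset.Icc 1 k, f m := by
  rw [Fin.sum_univ_eq_sum_range (fun m => f (m + 1)) k, Finset.range_eq_Ico,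
    Finset.sum_Ico_add' f 0 k 1]
  rfl

/-- Left inverse relation `B C = -1`. -/
theorem bc_rel (k : ℕ) (c b : ℕ → ℕ → ℤ)
    (hc : ∀ i, 1 ≤ i → i ≤ k → c i i = 1)
    (hbdiag : ∀ i, 1 ≤ i → i ≤ k → b i i = -1)
    (hbzero : ∀ i j, 1 ≤ j → j < i → i ≤ k → b i j = 0)
    (hbrec : ∀ i j, 1 ≤ i → i < j → j ≤ k →
      b i j = -∑ m ∈ Finset.Ioc i j, c i m * b m j) :
    (Matrix.of fun i j : Fin k => b ((i : ℕ) + 1) ((j : ℕ) + 1)) *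
      (-(Matrix.of fun i j : Fin k => if (i : ℕ) + 1 ≤ (j : ℕ) + 1 then
        c ((i : ℕ) + 1) ((j : ℕ) + 1) else 0)) = 1 := by
  rw [mul_eq_one_comm, neg_mul]
  ext i j
  rw [Matrix.neg_apply, Matrix.mul_apply]
  simp only [Matrix.of_apply]
  rw [sum_fin_Icc k (fun m => (if (i : ℕ) + 1 ≤ m then c ((i : ℕ) + 1) m else 0) *
    b m ((j : ℕ) + 1))]
  have hi := i.2
  have hj := j.2
  rw [← Finset.add_sum_erase _ _ (show (i : ℕ) + 1 ∈ Finset.Icc 1 k by simp)]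
  simp only [le_refl, if_true]
  rw [hc _ (by omega) (by omega), one_mul, Matrix.one_apply]
  have key : ∑ m ∈ (Finset.Icc 1 k).erase ((i : ℕ) + 1),
      (if (i : ℕ) + 1 ≤ m then c ((i : ℕ) + 1) m else 0) * b m ((j : ℕ) + 1) =
      ∑ m ∈ Finset.Ioc ((i : ℕ) + 1) ((j : ℕ) + 1), c ((i : ℕ) + 1) m * b m ((j : ℕ) + 1) := by
    symm
    apply Finset.sum_subset_zero_on_sdiff
    · intro m hm
      simp only [Finset.mem_Ioc, Finset.mem_erase, Finset.mem_Icc] at *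
      omega
    · intro m hm
      simp only [Finset.mem_Ioc, Finset.mem_erase, Finset.mem_Icc, Finset.mem_sdiff] at hm
      by_cases h : (i : ℕ) + 1 ≤ m
      · rw [hbzero m _ (by omega) (by omega) (by omega), mul_zero]
      · rw [if_neg h, zero_mul]
    · intro m hm
      simp only [Finset.mem_Ioc] at hm
      rw [if_pos (by omega)]
  rw [key]
  rcases lt_trichotomy (i : ℕ) j with h | h | h
  · rw [hbrec _ _ (by omega) (by omega) (by omega), if_neg (by rintro rfl; omega)]
    simp
  · have : i = j := Fin.ext h
    subst this
    simp [hbdiag _ (Nat.le_add_left 1 _) hi]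
  · rw [hbzero _ _ (by omega) (by omega) (by omega), if_neg (by rintro rfl; omega),
      Finset.Ioc_eq_empty (by omega)]
    simp

/-- the vectors `υ_{1,w_1}, …, υ_{k,w_k}` form the dual basis to
`a_{1,w_1}, …, a_{k,w_k}` with respect to the standard inner product on `ℝ^k`. -/
theorem upsilon_dual_basis (k : ℕ) (hk : 1 ≤ k) (c b : ℕ → ℕ → ℤ)
    (hc : ∀ i, 1 ≤ i → i ≤ k → c i i = 1)
    (hbdiag : ∀ i, 1 ≤ i → i ≤ k → b i i = -1)
    (hbzero : ∀ i j, 1 ≤ j → j < i → i ≤ k → b i j = 0)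
    (hbrec : ∀ i j, 1 ≤ i → i < j → j ≤ k →
      b i j = -∑ m ∈ Finset.Ioc i j, c i m * b m j)
    (w : ℕ → Bool) :
    ∀ i j : Fin k,
      ∑ m : Fin k, upsilonVec c w ((i : ℕ) + 1) ((m : ℕ) + 1) * aVec b w ((j : ℕ) + 1) ((m : ℕ) + 1)
        = if i = j then (1 : ℝ) else 0 := by
  intro i j
  have hi := i.2
  have hj := j.2
  cases hwj : w ((j : ℕ) + 1) with
  | false =>
    simp only [aVec, hwj, Bool.false_eq_true, if_false, mul_ite, mul_one, mul_zero,
      Nat.add_right_cancel_iff, Fin.val_inj]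
    rw [Finset.sum_ite_eq' Finset.univ j]
    simp only [Finset.mem_univ, if_true, upsilonVec, hwj, Bool.false_eq_true, and_false, if_false,
      add_zero, Nat.add_right_cancel_iff, Fin.val_inj]
    by_cases h : i = j
    · subst h
      simp [hwj]
    · simp [h, Ne.symm h]
  | true =>
    set n := (i : ℕ) + 1 with hn
    let g : Fin k → ℤ := fun l =>
      if (l : ℕ) + 1 ≤ n ∧ (w ((l : ℕ) + 1) = false ∨ (l : ℕ) + 1 = n) then
        betaAux c w n ((l : ℕ) + 1) else 0
    let u : Fin k → ℤ := fun m => (if (m : ℕ) + 1 = n then 1 else 0) +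
      if (m : ℕ) + 1 < n ∧ w ((m : ℕ) + 1) = true then betaAux c w n ((m : ℕ) + 1) else 0
    have hCg : (-(Matrix.of fun i j : Fin k => if (i : ℕ) + 1 ≤ (j : ℕ) + 1 then
        c ((i : ℕ) + 1) ((j : ℕ) + 1) else 0)).mulVec g = u := by
      funext m
      have hm := m.2
      rw [Matrix.neg_mulVec, Pi.neg_apply]
      simp only [Matrix.mulVec, dotProduct, Matrix.of_apply, g, u]
      rw [sum_fin_Icc k (fun l => (if (m : ℕ) + 1 ≤ l then c ((m : ℕ) + 1) l else 0) *
        (if l ≤ n ∧ (w l = false ∨ l = n) then betaAux c w n l else 0))]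
      rw [← Finset.add_sum_erase _ _ (show (m : ℕ) + 1 ∈ Finset.Icc 1 k by simp)]
      have key : ∑ l ∈ (Finset.Icc 1 k).erase ((m : ℕ) + 1),
          (if (m : ℕ) + 1 ≤ l then c ((m : ℕ) + 1) l else 0) *
          (if l ≤ n ∧ (w l = false ∨ l = n) then betaAux c w n l else 0) =
          ∑ l ∈ Finset.Ioc ((m : ℕ) + 1) n,
            (if (w l = false ∨ l = n) then c ((m : ℕ) + 1) l * betaAux c w n l else 0) := by
        symm
        apply Finset.sum_subset_zero_on_sdiff
        · intro l hl
          simp only [Finset.mem_Ioc, Finset.mem_erase, Finset.mem_Icc] at *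
          omega
        · intro l hl
          simp only [Finset.mem_Ioc, Finset.mem_erase, Finset.mem_Icc, Finset.mem_sdiff] at hl
          by_cases h : (m : ℕ) + 1 ≤ l
          · rw [if_neg (c := l ≤ n ∧ _) (by omega), mul_zero]
          · rw [if_neg h, zero_mul]
        · intro l hl
          simp only [Finset.mem_Ioc] at hl
          rw [if_pos (c := _ ≤ l) (by omega)]
          simp only [hl.2, true_and, mul_ite, mul_zero]
      rw [key]
      simp only [le_refl, if_true]
      rw [hc _ (by omega) (by omega), one_mul]
      rcases lt_trichotomy ((m : ℕ) + 1) n with h | h | h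
      · have hb := betaAux_lt c w n _ h
        have h' : (m : ℕ) + 1 ≠ n := by omega
        cases hw : w ((m : ℕ) + 1)
        · simp only [h, h.le, h', true_and, true_or, if_true, if_false, and_false,
            Bool.false_eq_true]
          rw [hb]; ring
        · simp only [h, h.le, h', true_and, or_false, if_true, if_false, Bool.true_eq_false,
            and_false]
          rw [hb]; ring
      · rw [h]
        simp [betaAux_self]
      · have h1 : ¬ ((m : ℕ) + 1 ≤ n) := by omega
        have h2 : ¬ ((m : ℕ) + 1 < n) := by omega
        have h3 : ¬ ((m : ℕ) + 1 = n) := by omega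
        rw [Finset.Ioc_eq_empty (by omega)]
        simp only [h1, h2, h3, false_and, if_false]
        simp
    have hBu := congrArg (Matrix.mulVec
      (Matrix.of fun i j : Fin k => b ((i : ℕ) + 1) ((j : ℕ) + 1))) hCg
    rw [Matrix.mulVec_mulVec, bc_rel k c b hc hbdiag hbzero hbrec, Matrix.one_mulVec] at hBu
    have hj' := congrFun hBu j
    simp only [Matrix.mulVec, dotProduct, Matrix.of_apply] at hj'
    have hups : ∀ m : Fin k, upsilonVec c w n ((m : ℕ) + 1) =
        (if w n then (-1 : ℝ) else 1) * (u m : ℝ) := by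
      intro m
      simp only [upsilonVec, u]
      congr 1
      push_cast
      congr 1
      by_cases h : (m : ℕ) + 1 < n ∧ w ((m : ℕ) + 1) = true
      · rw [if_pos h, if_pos ⟨trivial, h⟩, bott_eq_beta k c hc w n _ (by omega) h.1 (by omega)]
      · rw [if_neg h, if_neg (fun h' => h h'.2)]
        try simp
    have hsum : ∑ m : Fin k, upsilonVec c w n ((m : ℕ) + 1) * aVec b w ((j : ℕ) + 1) ((m : ℕ) + 1)
        = (if w n then (-1 : ℝ) else 1) * (g j : ℝ) := by
      rw [hj']
      push_cast
      rw [Finset.mul_sum]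
      apply Finset.sum_congr rfl
      intro m _
      rw [hups]
      simp only [aVec, hwj, if_true]
      ring
    rw [hsum]
    simp only [g, hwj]
    by_cases h : i = j
    · subst h
      simp [← hn, betaAux_self]
      simp [hn, hwj]
    · have h1 : (j : ℕ) + 1 ≠ n := by
        intro h'
        exact h (Fin.ext (by omega))
      simp [h, h1]
end

section
/- Let k ≥ 1, let c(i,j) be integers for 1 ≤ i < j ≤ k with c(i,i) := 1, and let b(i,j) be the associated Bott numbers. For every w = w_1…w_k ∈ {0,1}^k, the k×k integer matrix whose j-th row is a_{j,w_j} has determinant (-1)^{#{j : w_j = 1}}; in particular its determinant is ±1, so the vectors a_{1,w_1},…,a_{k,w_k} form a ℤ-basis of ℤ^k (i.e., each cone σ(w) of the fan Σ(k) is smooth). -/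
/-- The `k×k` integer matrix whose `j`-th row is the vector `a_{j, w_j}`:
`a_{j,0} = e_j` and `a_{j,1} = ∑_{m=j}^{k} b j m • e_m` (recall `b j m = 0` for `m < j`);
rows and columns are indexed 1-based via `Fin k`. -/
def aMat (b : ℕ → ℕ → ℤ) (w : ℕ → Bool) (k : ℕ) : Matrix (Fin k) (Fin k) ℤ :=
  Matrix.of fun j m =>
    if w ((j : ℕ) + 1) then b ((j : ℕ) + 1) ((m : ℕ) + 1) else if m = j then 1 else 0

/-- for every binary code `w ∈ {0,1}^k`, the matrix with rows
`a_{1,w_1}, …, a_{k,w_k}` has determinant `(-1)^{#{j : w_j = 1}}`; in particular it is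
`±1`, so the rows form a `ℤ`-basis of `ℤ^k` (each cone `σ(w)` is smooth). -/
theorem aMat_det_and_basis (k : ℕ) (hk : 1 ≤ k) (c b : ℕ → ℕ → ℤ)
    (hc : ∀ i, 1 ≤ i → i ≤ k → c i i = 1)
    (hbdiag : ∀ i, 1 ≤ i → i ≤ k → b i i = -1)
    (hbzero : ∀ i j, 1 ≤ j → j < i → i ≤ k → b i j = 0)
    (hbrec : ∀ i j, 1 ≤ i → i < j → j ≤ k →
      b i j = -∑ m ∈ Finset.Ioc i j, c i m * b m j)
    (w : ℕ → Bool) :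
    (aMat b w k).det = (-1 : ℤ) ^ ((Finset.univ.filter fun j : Fin k => w ((j : ℕ) + 1) = true).card) ∧
    IsUnit (aMat b w k).det ∧
    LinearIndependent ℤ (fun j : Fin k => aMat b w k j) ∧
    Submodule.span ℤ (Set.range fun j : Fin k => aMat b w k j) = ⊤ := by
  have hdet : (aMat b w k).det = (-1 : ℤ) ^
      ((Finset.univ.filter fun j : Fin k => w ((j : ℕ) + 1) = true).card) := by
    rw [Matrix.det_of_isUpperTriangular]
    · rw [← Finset.prod_const, Finset.prod_filter]
      refine Finset.prod_congr rfl fun j _ => ?_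
      simp only [aMat, Matrix.of_apply, if_true]
      rw [hbdiag _ (by omega) (by omega)]
    · intro i j hij
      have h : (j : ℕ) < i := hij
      simp only [aMat, Matrix.of_apply]
      rw [hbzero _ _ (by omega) (by omega) (by omega)]
      have h2 : j ≠ i := by
        intro e
        rw [e] at h
        omega
      simp [h2]
  have hu : IsUnit (aMat b w k).det := by
    rw [hdet]
    exact (isUnit_one.neg).pow _
  refine ⟨hdet, hu, ?_⟩
  refine (Module.Basis.is_basis_iff_det (Pi.basisFun ℤ (Fin k))).2 ?_
  rw [Pi.basisFun_det]
  exact hu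
end

section
/- Let k ≥ 1, let c(i,j) be integers for 1 ≤ i < j ≤ k with c(i,i) := 1, and let b(i,j) be the associated Bott numbers. Then the cones σ(w) := { ∑_{j=1}^k λ_j a_{j,w_j} : λ_j ≥ 0 }, as w ranges over {0,1}^k, cover ℝ^k: for every x ∈ ℝ^k there exist w ∈ {0,1}^k and nonnegative reals λ_1,…,λ_k with x = ∑_{j=1}^k λ_j a_{j,w_j} (completeness of the fan Σ(k)). -/
/-- the cones `σ(w) = {∑_j λ_j a_{j,w_j} : λ_j ≥ 0}`, as `w` ranges over
the binary codes of length `k`, cover `ℝ^k` (completeness of the fan `Σ(k)`). -/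
theorem sigma_cones_cover (k : ℕ) (hk : 1 ≤ k) (c b : ℕ → ℕ → ℤ)
    (hc : ∀ i, 1 ≤ i → i ≤ k → c i i = 1)
    (hbdiag : ∀ i, 1 ≤ i → i ≤ k → b i i = -1)
    (hbzero : ∀ i j, 1 ≤ j → j < i → i ≤ k → b i j = 0)
    (hbrec : ∀ i j, 1 ≤ i → i < j → j ≤ k →
      b i j = -∑ m ∈ Finset.Ioc i j, c i m * b m j) :
    ∀ x : Fin k → ℝ, ∃ w : ℕ → Bool, ∃ lam : Fin k → ℝ, (∀ j, 0 ≤ lam j) ∧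
      x = ∑ j : Fin k, lam j • (fun m : Fin k => aVec b w ((j : ℕ) + 1) ((m : ℕ) + 1)) := by
  intro x
  have key : ∀ n, n ≤ k → ∃ w : ℕ → Bool, ∃ lam : ℕ → ℝ, (∀ j, 0 ≤ lam j) ∧
      ∀ m : Fin k, (m : ℕ) < n →
        x m = ∑ j ∈ Finset.range n, lam j * aVec b w (j + 1) ((m : ℕ) + 1) := by
    intro n
    induction n with
    | zero => exact fun _ => ⟨fun _ => false, fun _ => 0, fun _ => le_rfl, fun m hm => by omega⟩
    | succ n ih =>
      intro hn
      obtain ⟨w, lam, hl, hx⟩ := ih (by omega)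
      obtain ⟨r, hr⟩ : ∃ r : ℝ, r = x ⟨n, by omega⟩ -
        ∑ j ∈ Finset.range n, lam j * aVec b w (j + 1) (n + 1) := ⟨_, rfl⟩
      refine ⟨Function.update w (n + 1) (decide (r < 0)), Function.update lam n |r|, ?_, ?_⟩
      · intro j
        by_cases h : j = n
        · subst h; simp
        · simp [Function.update_of_ne h, hl]
      · intro m hm
        rw [Finset.sum_range_succ]
        have e : ∑ j ∈ Finset.range n, Function.update lam n |r| j *
            aVec b (Function.update w (n + 1) (decide (r < 0))) (j + 1) ((m : ℕ) + 1)
            = ∑ j ∈ Finset.range n, lam j * aVec b w (j + 1) ((m : ℕ) + 1) := by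
          refine Finset.sum_congr rfl fun j hj => ?_
          have hj' : j ≠ n := (Finset.mem_range.1 hj).ne
          have hj2 : j + 1 ≠ n + 1 := by omega
          simp only [aVec, Function.update_of_ne hj', Function.update_of_ne hj2]
        rw [e]
        simp only [aVec, Function.update_self]
        by_cases h : (m : ℕ) = n
        · have hm' : m = ⟨n, hn⟩ := Fin.ext h
          rw [hm']
          dsimp only
          have hb := hbdiag (n + 1) (by omega) hn
          simp only [aVec] at hr
          by_cases h0 : r < 0
          · simp only [h0, hb, abs_of_neg h0, decide_true, if_true]
            simp only [Int.cast_neg, Int.cast_one]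
            linarith
          · simp only [h0, abs_of_nonneg (not_lt.1 h0), decide_false, if_true]
            simp only [Bool.false_eq_true, if_false]
            linarith
        · have hb := hbzero (n + 1) (m + 1) (by omega) (by omega) hn
          have := hx m (by omega)
          simp only [aVec] at this
          rw [← this]
          simp [hb, h]
  obtain ⟨w, lam, hl, hx⟩ := key k le_rfl
  refine ⟨w, fun j => lam j, fun j => hl j, ?_⟩
  funext m
  rw [hx m m.2, Finset.sum_apply, Finset.sum_range]
  simp
end

section
/- Let k ≥ 1, let c(i,j) be integers for 1 ≤ i < j ≤ k with c(i,i) := 1, and let b(i,j) be the associated Bott numbers. For distinct w, w' ∈ {0,1}^k, the topological interiors in ℝ^k of the cones σ(w) = { ∑_j λ_j a_{j,w_j} : λ_j ≥ 0 } and σ(w') = { ∑_j λ_j a_{j,w'_j} : λ_j ≥ 0 } are disjoint. -/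
lemma tri_aux {k : ℕ} (A A' : Fin k → Fin k → ℝ) (hA : ∀ j m, m < j → A j m = 0)
    (hA' : ∀ j m, m < j → A' j m = 0) (hd : ∀ j, A j j ≠ 0) (p : Fin k)
    (hAA : ∀ j, j < p → A j = A' j) (l l' y y' : Fin k → ℝ)
    (hy : y = ∑ j, l j • A j) (hy' : y' = ∑ j, l' j • A' j)
    (h : ∀ m, m < p → y m = y' m) :
    y p - y' p = l p * A p p - l' p * A' p p := by
  have key : ∀ m, m ≤ p → (∀ j, j < m → l j = l' j) →
      y m - y' m = l m * A m m - l' m * A' m m := by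
    intro m hm hl
    rw [hy, hy']
    simp only [Finset.sum_apply, Pi.smul_apply, smul_eq_mul]
    rw [← Finset.sum_sub_distrib]
    apply Finset.sum_eq_single m
    · intro j _ hj
      rcases lt_or_gt_of_ne hj with h1 | h1
      · rw [hl j h1, hAA j (lt_of_lt_of_le h1 hm), sub_self]
      · rw [hA j m h1, hA' j m h1]; simp
    · simp
  have hl : ∀ n : ℕ, ∀ j : Fin k, (j : ℕ) = n → j < p → l j = l' j := by
    intro n
    induction n using Nat.strong_induction_on with
    | _ n ih =>
      intro j hj hjp
      have h1 := key j hjp.le (fun i hi => ih i (by rw [← hj]; exact hi) i rfl (hi.trans hjp))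
      rw [h j hjp, ← hAA j hjp, sub_self, ← sub_mul] at h1
      rcases mul_eq_zero.1 h1.symm with h2 | h2
      · linarith
      · exact absurd h2 (hd j)
  exact key p le_rfl (fun j hj => hl j j rfl hj)

/-- for distinct binary codes `w ≠ w'` of length `k`, the topological
interiors of the cones `σ(w)` and `σ(w')` in `ℝ^k` are disjoint. -/
theorem sigma_cones_interiors_disjoint (k : ℕ) (hk : 1 ≤ k) (c b : ℕ → ℕ → ℤ)
    (hc : ∀ i, 1 ≤ i → i ≤ k → c i i = 1)
    (hbdiag : ∀ i, 1 ≤ i → i ≤ k → b i i = -1)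
    (hbzero : ∀ i j, 1 ≤ j → j < i → i ≤ k → b i j = 0)
    (hbrec : ∀ i j, 1 ≤ i → i < j → j ≤ k →
      b i j = -∑ m ∈ Finset.Ioc i j, c i m * b m j)
    (w w' : ℕ → Bool) (hne : ∃ j, 1 ≤ j ∧ j ≤ k ∧ w j ≠ w' j) :
    interior {y : Fin k → ℝ | ∃ lam : Fin k → ℝ, (∀ j, 0 ≤ lam j) ∧
        y = ∑ j : Fin k, lam j • (fun m : Fin k => aVec b w ((j : ℕ) + 1) ((m : ℕ) + 1))} ∩
      interior {y : Fin k → ℝ | ∃ lam : Fin k → ℝ, (∀ j, 0 ≤ lam j) ∧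
        y = ∑ j : Fin k, lam j • (fun m : Fin k => aVec b w' ((j : ℕ) + 1) ((m : ℕ) + 1))} = ∅ := by
  have hz : ∀ v : ℕ → Bool, ∀ j m : Fin k, m < j → aVec b v ((j : ℕ) + 1) ((m : ℕ) + 1) = 0 := by
    intro v j m hmj
    have h1 : (m : ℕ) < j := hmj
    have h2 := hbzero (j + 1) (m + 1) (by omega) (by omega) (by omega)
    unfold aVec
    rw [h2, if_neg (show ¬ ((m : ℕ) + 1 = j + 1) by omega)]
    simp
  have hdg : ∀ v : ℕ → Bool, ∀ j : Fin k,
      aVec b v ((j : ℕ) + 1) ((j : ℕ) + 1) = if v (j + 1) then -1 else 1 := by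
    intro v j
    unfold aVec
    rw [hbdiag (j + 1) (by omega) (by omega)]
    simp
  have hd : ∀ v : ℕ → Bool, ∀ j : Fin k, aVec b v ((j : ℕ) + 1) ((j : ℕ) + 1) ≠ 0 := by
    intro v j
    rw [hdg]
    split_ifs <;> norm_num
  obtain ⟨p, hp, hmin⟩ : ∃ p : Fin k, w (p + 1) ≠ w' (p + 1) ∧
      ∀ j : Fin k, j < p → w (j + 1) = w' (j + 1) := by
    have hex : ∃ n, n < k ∧ w (n + 1) ≠ w' (n + 1) := by
      obtain ⟨j, h1, h2, h3⟩ := hne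
      refine ⟨j - 1, by omega, ?_⟩
      rwa [Nat.sub_add_cancel h1]
    classical
    refine ⟨⟨Nat.find hex, (Nat.find_spec hex).1⟩, (Nat.find_spec hex).2, ?_⟩
    intro j hj
    by_contra hcon
    exact Nat.find_min hex (m := j) hj ⟨j.2, hcon⟩
  rw [Set.eq_empty_iff_forall_notMem]
  intro y hyU
  rw [← interior_inter] at hyU
  have hcont : Continuous (fun t : ℝ => y + t • (Pi.single p 1 : Fin k → ℝ)) := by fun_prop
  have hnh := hcont.continuousAt.preimage_mem_nhds (x := 0)
    (by rw [zero_smul, add_zero]; exact mem_interior_iff_mem_nhds.1 hyU)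
  obtain ⟨ε, hε, hball⟩ := Metric.mem_nhds_iff.1 hnh
  have ht : (ε / 2) ∈ Metric.ball (0 : ℝ) ε := by
    rw [Metric.mem_ball, Real.dist_eq, sub_zero, abs_of_pos (by linarith)]; linarith
  obtain ⟨⟨l2, hl2, hy2⟩, ⟨m2, hm2, hz2⟩⟩ := hball ht
  obtain ⟨⟨l1, hl1, hy1⟩, ⟨m1, hm1, hz1⟩⟩ := interior_subset hyU
  have hAA : ∀ j : Fin k, j < p → (fun m : Fin k => aVec b w ((j : ℕ) + 1) ((m : ℕ) + 1)) =
      (fun m : Fin k => aVec b w' ((j : ℕ) + 1) ((m : ℕ) + 1)) := by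
    intro j hj
    funext m
    unfold aVec
    rw [hmin j hj]
  have e1 := tri_aux _ _ (hz w) (hz w') (hd w) p hAA _ _ _ _ hy1 hz1 (fun _ _ => rfl)
  have e2 := tri_aux _ _ (hz w) (hz w') (hd w) p hAA _ _ _ _ hy2 hz2 (fun _ _ => rfl)
  have e3 := tri_aux _ _ (hz w) (hz w) (hd w) p (fun _ _ => rfl) _ _ _ _ hy2 hy1
    (fun m hm => by simp [hm.ne])
  simp only [hdg, sub_self] at e1 e2 e3
  simp at e3
  have := hl1 p
  have := hl2 p
  have := hm1 p
  have := hm2 p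
  cases h1 : w (p + 1) <;> cases h2 : w' (p + 1) <;> simp [h1, h2] at hp e1 e2 e3 <;> linarith
end

section
/- Let n ≥ 1 and let 0 < U_1 < U_2 < … < U_n < ℂ^{n+1} be a bounded flag, i.e., a complete flag of complex subspaces (dim U_i = i) such that ℂ_{[i-1]} ≤ U_i for each 1 ≤ i ≤ n. Then there exist one-dimensional subspaces L_1,…,L_{n+1} of ℂ^{n+1} with L_{n+1} = ℂω_{n+1}, such that L_i ≤ ℂω_i + L_{i+1} for each 1 ≤ i ≤ n, and U_i = ℂ_{[i-1]} ⊕ L_i (i.e., U_i = ℂ_{[i-1]} + L_i with ℂ_{[i-1]} ∩ L_i = 0) for each 1 ≤ i ≤ n. -/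
/-- `ℂ_{[j]}`: the coordinate subspace of `ℂ^{n+1}` spanned by the first `j` standard
basis vectors `ω_1, …, ω_j` (0-based indices `0, …, j-1`). -/
noncomputable def stdSub (n j : ℕ) : Submodule ℂ (Fin (n + 1) → ℂ) :=
  Submodule.span ℂ {v | ∃ i : Fin (n + 1), (i : ℕ) < j ∧ v = Pi.single i 1}

/-- vectors vanishing on the first `j` coordinates -/
def tailSub (n j : ℕ) : Submodule ℂ (Fin (n + 1) → ℂ) where
  carrier := {v | ∀ k : Fin (n + 1), (k : ℕ) < j → v k = 0}
  add_mem' := by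
    intro a b ha hb k hk
    simp [ha k hk, hb k hk]
  zero_mem' := by
    intro k hk
    rfl
  smul_mem' := by
    intro c a ha k hk
    simp [ha k hk]

lemma mem_tailSub {n j : ℕ} {v : Fin (n + 1) → ℂ} :
    v ∈ tailSub n j ↔ ∀ k : Fin (n + 1), (k : ℕ) < j → v k = 0 := Iff.rfl

lemma stdSub_vanish {n j : ℕ} {v : Fin (n + 1) → ℂ} (hv : v ∈ stdSub n j)
    (k : Fin (n + 1)) (hk : j ≤ (k : ℕ)) : v k = 0 := by
  have h : stdSub n j ≤ LinearMap.ker (LinearMap.proj k : (Fin (n + 1) → ℂ) →ₗ[ℂ] ℂ) := by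
    refine Submodule.span_le.2 ?_
    rintro _ ⟨i, hi, rfl⟩
    have : k ≠ i := by
      rintro rfl
      omega
    simp [this]
  simpa using h hv

lemma single_mem_stdSub {n j : ℕ} (i : Fin (n + 1)) (hi : (i : ℕ) < j) :
    (Pi.single i 1 : Fin (n + 1) → ℂ) ∈ stdSub n j :=
  Submodule.subset_span ⟨i, hi, rfl⟩

lemma isCompl_std_tail (n j : ℕ) : IsCompl (stdSub n j) (tailSub n j) := by
  constructor
  · rw [Submodule.disjoint_def]
    intro v h1 h2
    funext k
    rcases lt_or_ge (k : ℕ) j with h | h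
    · exact h2 k h
    · exact stdSub_vanish h1 k h
  · rw [codisjoint_iff, eq_top_iff, ← (Pi.basisFun ℂ (Fin (n + 1))).span_eq, Submodule.span_le]
    rintro _ ⟨i, rfl⟩
    rw [Pi.basisFun_apply]
    rcases lt_or_ge (i : ℕ) j with h | h
    · exact Submodule.mem_sup_left (single_mem_stdSub i h)
    · refine Submodule.mem_sup_right ?_
      intro k hk
      have : k ≠ i := by
        rintro rfl
        omega
      simp [this]

lemma finrank_stdSub (n j : ℕ) (hj : j ≤ n + 1) : Module.finrank ℂ (stdSub n j) = j := by
  have h1 : stdSub n j = Submodule.span ℂ (Set.range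
      (fun i : {i : Fin (n + 1) // (i : ℕ) < j} => (Pi.single i.1 1 : Fin (n + 1) → ℂ))) := by
    unfold stdSub
    congr 1
    ext v
    constructor
    · rintro ⟨i, hi, rfl⟩
      exact ⟨⟨i, hi⟩, rfl⟩
    · rintro ⟨⟨i, hi⟩, rfl⟩
      exact ⟨i, hi, rfl⟩
  have h2 : LinearIndependent ℂ
      (fun i : {i : Fin (n + 1) // (i : ℕ) < j} => (Pi.single i.1 1 : Fin (n + 1) → ℂ)) := by
    have := (Pi.basisFun ℂ (Fin (n + 1))).linearIndependent.comp
      (fun i : {i : Fin (n + 1) // (i : ℕ) < j} => i.1) Subtype.val_injective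
    convert this using 2
    simp
  rw [h1, finrank_span_eq_card h2, Fintype.card_subtype, Fin.card_filter_val_lt]
  omega


/-- any bounded flag `0 < U_1 < … < U_n < ℂ^{n+1}` (i.e. `dim U_i = i` and
`ℂ_{[i-1]} ≤ U_i`) admits lines `L_1, …, L_{n+1}` with `L_{n+1} = ℂ ω_{n+1}`,
`L_i ≤ ℂ ω_i + L_{i+1}`, and `U_i = ℂ_{[i-1]} ⊕ L_i` for `1 ≤ i ≤ n`. -/
theorem bounded_flag_decomposition (n : ℕ) (hn : 1 ≤ n)
    (U : ℕ → Submodule ℂ (Fin (n + 1) → ℂ))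
    (hdim : ∀ i, 1 ≤ i → i ≤ n → Module.finrank ℂ (U i) = i)
    (hchain : ∀ i, 1 ≤ i → i < n → U i < U (i + 1))
    (hbdd : ∀ i, 1 ≤ i → i ≤ n → stdSub n (i - 1) ≤ U i) :
    ∃ L : ℕ → Submodule ℂ (Fin (n + 1) → ℂ),
      (∀ i, 1 ≤ i → i ≤ n + 1 → Module.finrank ℂ (L i) = 1) ∧
      L (n + 1) = Submodule.span ℂ {Pi.single (Fin.last n) (1 : ℂ)} ∧
      (∀ i (_ : 1 ≤ i) (h2 : i ≤ n),
        L i ≤ Submodule.span ℂ {Pi.single (⟨i - 1, by omega⟩ : Fin (n + 1)) (1 : ℂ)} ⊔ L (i + 1)) ∧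
      (∀ i, 1 ≤ i → i ≤ n →
        U i = stdSub n (i - 1) ⊔ L i ∧ stdSub n (i - 1) ⊓ L i = ⊥) := by
  obtain ⟨V, hVU, hVtop⟩ : ∃ V : ℕ → Submodule ℂ (Fin (n + 1) → ℂ),
      (∀ i, i ≤ n → V i = U i) ∧ V (n + 1) = ⊤ :=
    ⟨fun i => if i ≤ n then U i else ⊤, fun i hi => by simp [hi], by simp⟩
  have hVdim : ∀ i, 1 ≤ i → i ≤ n + 1 → Module.finrank ℂ (V i) = i := by
    intro i h1 h2
    rcases Nat.lt_or_ge n i with h | h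
    · obtain rfl : i = n + 1 := by omega
      rw [hVtop]
      simp
    · rw [hVU i h, hdim i h1 h]
  have hVbdd : ∀ i, 1 ≤ i → i ≤ n + 1 → stdSub n (i - 1) ≤ V i := by
    intro i h1 h2
    rcases Nat.lt_or_ge n i with h | h
    · obtain rfl : i = n + 1 := by omega
      rw [hVtop]
      exact le_top
    · rw [hVU i h]
      exact hbdd i h1 h
  have hVle : ∀ i, 1 ≤ i → i ≤ n → V i ≤ V (i + 1) := by
    intro i h1 h2
    rcases Nat.lt_or_ge i n with h | h
    · rw [hVU i h2, hVU (i + 1) h]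
      exact (hchain i h1 h).le
    · obtain rfl : i = n := by omega
      rw [hVtop]
      exact le_top
  have hsup : ∀ i, 1 ≤ i → i ≤ n + 1 →
      stdSub n (i - 1) ⊔ (tailSub n (i - 1) ⊓ V i) = V i := by
    intro i h1 h2
    rw [← sup_inf_assoc_of_le _ (hVbdd i h1 h2), (isCompl_std_tail n (i - 1)).sup_eq_top,
      top_inf_eq]
  have hinf : ∀ i, stdSub n (i - 1) ⊓ (tailSub n (i - 1) ⊓ V i) = ⊥ := by
    intro i
    rw [← inf_assoc, (isCompl_std_tail n (i - 1)).inf_eq_bot, bot_inf_eq]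
  refine ⟨fun i => tailSub n (i - 1) ⊓ V i, ?_, ?_, ?_, ?_⟩
  · intro i h1 h2
    have h := Submodule.finrank_sup_add_finrank_inf_eq (stdSub n (i - 1))
      (tailSub n (i - 1) ⊓ V i)
    rw [hsup i h1 h2, hinf i, finrank_bot, hVdim i h1 h2,
      finrank_stdSub n (i - 1) (by omega)] at h
    show Module.finrank ℂ (tailSub n (i - 1) ⊓ V i : Submodule ℂ (Fin (n + 1) → ℂ)) = 1
    omega
  · show tailSub n (n + 1 - 1) ⊓ V (n + 1) = _
    rw [hVtop, inf_top_eq]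
    ext v
    rw [mem_tailSub, Submodule.mem_span_singleton]
    constructor
    · intro hv
      refine ⟨v (Fin.last n), ?_⟩
      funext k
      by_cases hk : k = Fin.last n
      · subst hk
        simp
      · have h3 : (k : ℕ) ≠ n := fun h => hk (Fin.ext h)
        have := hv k (by omega)
        simp [hk, this]
    · rintro ⟨c, rfl⟩ k hk
      have hk' : k ≠ Fin.last n := by
        rintro rfl
        simp at hk
      simp [hk']
  · intro i h1 h2 v hv
    obtain ⟨hvT, hvV⟩ := hv
    set p : Fin (n + 1) := ⟨i - 1, by omega⟩ with hp
    have hs : v p • (Pi.single p 1 : Fin (n + 1) → ℂ) ∈ V (i + 1) :=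
      Submodule.smul_mem _ _ (hVbdd (i + 1) (by omega) (by omega)
        (single_mem_stdSub p (by simp [hp]; omega)))
    refine Submodule.mem_sup.2 ⟨v p • Pi.single p 1,
      Submodule.smul_mem _ _ (Submodule.mem_span_singleton_self _),
      v - v p • Pi.single p 1, ⟨?_, Submodule.sub_mem _ (hVle i h1 h2 hvV) hs⟩, by abel⟩
    intro k hk
    by_cases hkp : k = p
    · rw [hkp]
      simp
    · have h3 : (k : ℕ) ≠ i - 1 := fun h => hkp (Fin.ext h)
      have := hvT k (by omega)
      simp [hkp, this]
  · intro i h1 h2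
    refine ⟨?_, hinf i⟩
    show U i = stdSub n (i - 1) ⊔ (tailSub n (i - 1) ⊓ V i)
    rw [hsup i h1 (by omega), hVU i h2]
end

section
/- Let n ≥ 1 and let (x,y), (x',y') ∈ (ℂ²∖0)^n. Define l_{n+1} := ω_{n+1}, l_j := x_j ω_j + y_j l_{j+1}, and U(x,y)_i := ℂ_{[i-1]} + ℂ l_i for 1 ≤ i ≤ n, and similarly for (x',y'). Then U(x,y)_i = U(x',y')_i for all 1 ≤ i ≤ n if and only if there exists t = (t_1,…,t_n) ∈ (ℂ^×)^n such that x'_j = x_j t_j for all 1 ≤ j ≤ n, y'_j = y_j t_j t_{j+1}^{-1} for all 1 ≤ j ≤ n-1, and y'_n = y_n t_n. In other words, two points of (ℂ²∖0)^n determine the same bounded flag exactly when they lie in the same orbit of the torus action (x_1,y_1;…;x_n,y_n)·t = (x_1 t_1, y_1 t_1 t_2^{-1}; …; x_{n-1} t_{n-1}, y_{n-1} t_{n-1} t_n^{-1}; x_n t_n, y_n t_n). -/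
/-- Auxiliary descending recursion: `lAux n x y m = l_{n+1-m}`, where `l_{n+1} = ω_{n+1}`
and `l_j = x_j ω_j + y_j l_{j+1}`. -/
noncomputable def lAux (n : ℕ) (x y : ℕ → ℂ) : ℕ → (Fin (n + 1) → ℂ)
  | 0 => Pi.single (Fin.last n) 1
  | m + 1 => x (n - m) • (Pi.single (⟨n - m - 1, by omega⟩ : Fin (n + 1)) 1 : Fin (n + 1) → ℂ) + y (n - m) • lAux n x y m

/-- The vector `l_j` (`1 ≤ j ≤ n+1`), defined by `l_{n+1} = ω_{n+1}`,
`l_j = x_j ω_j + y_j l_{j+1}`. -/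
noncomputable def lvec (n : ℕ) (x y : ℕ → ℂ) (j : ℕ) : Fin (n + 1) → ℂ :=
  lAux n x y (n + 1 - j)

/-- The `i`-th subspace `U(x,y)_i = ℂ_{[i-1]} + ℂ l_i` of the flag `U(x,y)`. -/
noncomputable def flagOf (n : ℕ) (x y : ℕ → ℂ) (i : ℕ) : Submodule ℂ (Fin (n + 1) → ℂ) :=
  stdSub n (i - 1) ⊔ Submodule.span ℂ {lvec n x y i}

theorem lvec_last (n : ℕ) (x y : ℕ → ℂ) :
    lvec n x y (n + 1) = Pi.single (Fin.last n) 1 := by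
  simp [lvec, lAux]

theorem lvec_step (n : ℕ) (x y : ℕ → ℂ) (j : ℕ) (h : j + 1 ≤ n) :
    lvec n x y (j + 1) = x (j + 1) • (Pi.single (⟨j, by omega⟩ : Fin (n + 1)) 1 : Fin (n + 1) → ℂ)
      + y (j + 1) • lvec n x y (j + 2) := by
  obtain ⟨m, rfl⟩ : ∃ m, n = j + 1 + m := ⟨n - (j + 1), by omega⟩
  have e1 : j + 1 + m + 1 - (j + 1) = m + 1 := by omega
  have e2 : j + 1 + m + 1 - (j + 2) = m := by omega
  have e3 : j + 1 + m - m = j + 1 := by omega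
  simp only [lvec, e1, e2, lAux, e3, Nat.add_sub_cancel]

theorem lvec_induct (n : ℕ) (P : ℕ → Prop) (h0 : P n)
    (hs : ∀ j, j + 1 ≤ n → P (j + 1) → P j) (j : ℕ) (hj : j ≤ n) : P j := by
  obtain ⟨d, hd⟩ : ∃ d, j + d = n := ⟨n - j, by omega⟩
  induction d generalizing j with
  | zero => simp at hd; rwa [hd]
  | succ d ih => exact hs j (by omega) (ih (j + 1) (by omega) (by omega))

theorem lvec_supp (n : ℕ) (x y : ℕ → ℂ) (j : ℕ) (hj : j ≤ n) :
    ∀ k : Fin (n + 1), (k : ℕ) < j → lvec n x y (j + 1) k = 0 := by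
  refine lvec_induct n (fun j => ∀ k : Fin (n + 1), (k : ℕ) < j → lvec n x y (j + 1) k = 0)
    ?_ ?_ j hj
  · intro k hk
    rw [lvec_last, Pi.single_eq_of_ne]
    rintro rfl
    simp at hk
  · intro j hj ih k hk
    rw [lvec_step n x y j hj]
    have h1 : k ≠ ⟨j, by omega⟩ := by
      intro h
      rw [h] at hk
      simp at hk
    simp [Pi.single_eq_of_ne h1, ih k (by omega)]

theorem lvec_coord (n : ℕ) (x y : ℕ → ℂ) (j : ℕ) (h : j + 1 ≤ n) :
    lvec n x y (j + 1) ⟨j, by omega⟩ = x (j + 1) := by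
  rw [lvec_step n x y j h]
  simp [lvec_supp n x y (j + 1) h ⟨j, by omega⟩ (by simp)]

theorem lvec_ne (n : ℕ) (x y : ℕ → ℂ)
    (hxy : ∀ j, 1 ≤ j → j ≤ n → ¬(x j = 0 ∧ y j = 0)) (j : ℕ) (hj : j ≤ n) :
    lvec n x y (j + 1) ≠ 0 := by
  refine lvec_induct n (fun j => lvec n x y (j + 1) ≠ 0) ?_ ?_ j hj
  · rw [lvec_last]; simp
  · intro j hj ih h0
    have hx : x (j + 1) = 0 := by rw [← lvec_coord n x y j hj, h0]; rfl
    rw [lvec_step n x y j hj, hx] at h0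
    simp only [zero_smul, zero_add, smul_eq_zero] at h0
    exact hxy (j + 1) (by omega) hj ⟨hx, h0.resolve_right ih⟩

theorem stdSub_supp (n m : ℕ) (v : Fin (n + 1) → ℂ) (hv : v ∈ stdSub n m)
    (k : Fin (n + 1)) (hk : m ≤ k) : v k = 0 := by
  unfold stdSub at hv
  induction hv using Submodule.span_induction with
  | mem v h =>
    obtain ⟨i, hi, rfl⟩ := h
    rw [Pi.single_eq_of_ne]
    rintro rfl
    omega
  | zero => rfl
  | add a b _ _ ha hb => simp [ha, hb]
  | smul c a _ ha => simp [ha]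

theorem flag_scalar (n : ℕ) (x y x' y' : ℕ → ℂ)
    (hxy' : ∀ j, 1 ≤ j → j ≤ n → ¬(x' j = 0 ∧ y' j = 0)) (j : ℕ) (hj : j ≤ n)
    (h : flagOf n x y (j + 1) = flagOf n x' y' (j + 1)) :
    ∃ c : ℂ, c ≠ 0 ∧ lvec n x' y' (j + 1) = c • lvec n x y (j + 1) := by
  have hm : lvec n x' y' (j + 1) ∈ flagOf n x y (j + 1) := by
    rw [h]
    exact Submodule.mem_sup_right (Submodule.mem_span_singleton_self _)
  obtain ⟨s, hs, w, hw, e⟩ := Submodule.mem_sup.1 hm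
  obtain ⟨c, rfl⟩ := Submodule.mem_span_singleton.1 hw
  have e2 : lvec n x' y' (j + 1) = c • lvec n x y (j + 1) := by
    funext k
    by_cases hk : (k : ℕ) < j
    · simp [lvec_supp n x y j hj k hk, lvec_supp n x' y' j hj k hk]
    · rw [← e]
      simp [stdSub_supp n _ s hs k (by simpa using hk)]
  refine ⟨c, ?_, e2⟩
  rintro rfl
  exact lvec_ne n x' y' hxy' j hj (by simpa using e2)


/-- two points `(x,y), (x',y') ∈ (ℂ²∖0)^n` determine the same bounded flag
`U(x,y) = U(x',y')` if and only if they lie in the same orbit of the torus action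
`(x_1,y_1;…;x_n,y_n)·t = (x_1 t_1, y_1 t_1 t_2⁻¹; …; x_{n-1} t_{n-1}, y_{n-1} t_{n-1} t_n⁻¹;
x_n t_n, y_n t_n)`. -/
theorem flagOf_eq_iff_torus_orbit (n : ℕ) (hn : 1 ≤ n)
    (x y x' y' : ℕ → ℂ)
    (hxy : ∀ j, 1 ≤ j → j ≤ n → ¬(x j = 0 ∧ y j = 0))
    (hxy' : ∀ j, 1 ≤ j → j ≤ n → ¬(x' j = 0 ∧ y' j = 0)) :
    (∀ i, 1 ≤ i → i ≤ n → flagOf n x y i = flagOf n x' y' i) ↔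
      ∃ t : ℕ → ℂ, (∀ j, 1 ≤ j → j ≤ n → t j ≠ 0) ∧
        (∀ j, 1 ≤ j → j ≤ n → x' j = x j * t j) ∧
        (∀ j, 1 ≤ j → j ≤ n - 1 → y' j = y j * t j * (t (j + 1))⁻¹) ∧
        y' n = y n * t n := by
  constructor
  · intro h
    have key : ∀ j, ∃ c : ℂ, j ≤ n → (c ≠ 0 ∧ (j = n → c = 1) ∧
        lvec n x' y' (j + 1) = c • lvec n x y (j + 1)) := by
      intro j
      rcases lt_trichotomy j n with hj | hj | hj
      · obtain ⟨c, hc, e⟩ := flag_scalar n x y x' y' hxy' j hj.le (h (j + 1) (by omega) hj)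
        exact ⟨c, fun _ => ⟨hc, fun h => by omega, e⟩⟩
      · subst hj
        exact ⟨1, fun _ => ⟨one_ne_zero, fun _ => rfl, by simp [lvec_last]⟩⟩
      · exact ⟨1, fun h => by omega⟩
    choose c hc using key
    have hx : ∀ j, j + 1 ≤ n → x' (j + 1) = x (j + 1) * c j := by
      intro j hj
      have := congrFun (hc j (by omega)).2.2 ⟨j, by omega⟩
      rw [lvec_coord n x' y' j hj, Pi.smul_apply, lvec_coord n x y j hj, smul_eq_mul] at this
      rw [this, mul_comm]
    have hy : ∀ j, j + 1 ≤ n → y' (j + 1) * c (j + 1) = y (j + 1) * c j := by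
      intro j hj
      have e := (hc j (by omega)).2.2
      rw [lvec_step n x' y' j hj, lvec_step n x y j hj, (hc (j + 1) hj).2.2, hx j hj, smul_add,
        smul_smul, smul_smul, smul_smul, mul_comm (c j) (x (j + 1)), add_right_inj] at e
      rw [smul_left_injective ℂ (lvec_ne n x y hxy (j + 1) hj) e, mul_comm]
    refine ⟨fun j => c (j - 1), ?_, ?_, ?_, ?_⟩
    · intro j h1 h2
      exact (hc (j - 1) (by omega)).1
    · intro j h1 h2
      obtain ⟨j, rfl⟩ : ∃ k, j = k + 1 := ⟨j - 1, by omega⟩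
      exact hx j h2
    · intro j h1 h2
      obtain ⟨j, rfl⟩ : ∃ k, j = k + 1 := ⟨j - 1, by omega⟩
      have := hy j (by omega)
      have h3 := (hc (j + 1) (by omega)).1
      simp only [Nat.add_sub_cancel]
      rw [← this, mul_inv_cancel_right₀ h3]
    · obtain ⟨j, rfl⟩ : ∃ k, n = k + 1 := ⟨n - 1, by omega⟩
      have := hy j le_rfl
      rw [(hc (j + 1) le_rfl).2.1 rfl, mul_one] at this
      exact this
  · rintro ⟨t, h0, hx, hy, hyn⟩ i h1 h2
    have key : ∀ j, j ≤ n → ∃ c : ℂ, (j + 1 ≤ n → c = t (j + 1)) ∧ (j = n → c = 1) ∧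
        lvec n x' y' (j + 1) = c • lvec n x y (j + 1) := by
      refine lvec_induct n _ ⟨1, fun h => by omega, fun _ => rfl, by simp [lvec_last]⟩ ?_
      rintro j hj ⟨c, hc1, hc2, hc⟩
      refine ⟨t (j + 1), fun _ => rfl, fun h => by omega, ?_⟩
      have e : y' (j + 1) * c = t (j + 1) * y (j + 1) := by
        by_cases hjn : j + 1 = n
        · rw [hc2 hjn, hjn, hyn]; ring
        · rw [hc1 (by omega), hy (j + 1) (by omega) (by omega)]
          have := h0 (j + 1 + 1) (by omega) (by omega)
          field_simp
      rw [lvec_step n x' y' j hj, lvec_step n x y j hj, hc, hx (j + 1) (by omega) hj, smul_add,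
        smul_smul, smul_smul, smul_smul, e, mul_comm (x (j + 1))]
    obtain ⟨i, rfl⟩ : ∃ k, i = k + 1 := ⟨i - 1, by omega⟩
    obtain ⟨c, hc, -, e⟩ := key i (by omega)
    have hc0 : c ≠ 0 := by rw [hc h2]; exact h0 _ h1 h2
    unfold flagOf
    rw [e, Submodule.span_singleton_smul_eq (IsUnit.mk0 c hc0)]
end
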